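/- The g+1 polynomial differential operators ℒ, ℬ₃, ℬ₅, …, ℬ_{2g+1} pairwise commute as ℂ-linear endomorphisms of B_g. -/

import Mathlib

open MvPolynomial

noncomputable section

/-- B_g = ℂ[b_{i,j} : i ∈ {1,2,3}, j odd, 1 ≤ j ≤ 2g−1], as a polynomial ring in 3g variables;
the variable (i, m) : Fin 3 × Fin g stands for b_{i+1, 2m+1}. -/
abbrev Bg (g : ℕ) : Type := MvPolynomial (Fin 3 × Fin g) ℂ

/-- `bb g i m` is the variable b_{i, 2m−1} (zero if i ∉ {1,2,3} or m ∉ {1,…,g}). -/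
noncomputable def bb (g : ℕ) (i m : ℕ) : Bg g :=
  if h : 1 ≤ i ∧ i ≤ 3 ∧ 1 ≤ m ∧ m ≤ g then
    MvPolynomial.X (⟨i - 1, by omega⟩, ⟨m - 1, by omega⟩) else 0

/-- `bv g i j` is the variable b_{i,j} for odd j (zero for j > 2g−1). -/
noncomputable def bv (g : ℕ) (i j : ℕ) : Bg g :=
  if Odd j then bb g i ((j + 1) / 2) else 0

/-- `Qg g a c` is p_{2a−1, 2c−1} for 1 ≤ a ≤ c, by the elimination recursion. -/
noncomputable def Qg (g : ℕ) : ℕ → ℕ → Bg g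
  | 0, _ => 0
  | 1, c => 2 * bb g 1 c
  | 2, c => 6 * bb g 1 1 * bb g 1 c - bb g 3 c + 6 * bb g 1 (c + 1)
  | 3, c => bb g 3 1 * bb g 1 c - bb g 2 1 * bb g 2 c + bb g 1 1 * bb g 3 c
      - 2 * (4 * bb g 1 1 ^ 2 + bb g 1 2) * bb g 1 c
      + 10 * bb g 1 1 * bb g 1 (c + 1) - 2 * bb g 3 (c + 1) + 10 * bb g 1 (c + 2)
  | (a + 4), c => 2 * (if c + 1 ≤ g then Qg g (a + 3) (c + 1) else 0)
      - (if c + 2 ≤ g then Qg g (a + 2) (c + 2) else 0)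
      - 8 * bb g 1 1 * bb g 1 (a + 2) * bb g 1 c - 2 * bb g 1 c * bb g 1 (a + 3)
      - 2 * bb g 1 (a + 2) * bb g 1 (c + 1) + bb g 1 (a + 2) * bb g 3 c
      - bb g 2 (a + 2) * bb g 2 c + bb g 3 (a + 2) * bb g 1 c

/-- `pp g k l` is p_{k,l} for odd k, l (zero if k > 2g−1 or l > 2g−1). -/
noncomputable def pp (g : ℕ) (k l : ℕ) : Bg g :=
  if Odd k ∧ Odd l ∧ k ≤ 2 * g - 1 ∧ l ≤ 2 * g - 1 then
    if k ≤ l then Qg g ((k + 1) / 2) ((l + 1) / 2) else Qg g ((l + 1) / 2) ((k + 1) / 2)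
  else 0

/-- 𝐛ᵢ(ξ) = Σ_{m=1}^{g} b_{i,2m−1} ξᵐ ∈ B_g[ξ]. -/
noncomputable def Bcoef (g i : ℕ) : Polynomial (Bg g) :=
  ∑ m ∈ Finset.Icc 1 g, Polynomial.C (bb g i m) * Polynomial.X ^ m

/-- The polynomial ξ𝐛₂(ξ)² + 2ξ𝐛₃(ξ)(1 − 𝐛₁(ξ)) + 4(1 + 2b_{1,1}ξ)(1 − 𝐛₁(ξ))². -/
noncomputable def Fg (g : ℕ) : Polynomial (Bg g) :=
  Polynomial.X * (Bcoef g 2) ^ 2 + 2 * Polynomial.X * Bcoef g 3 * (1 - Bcoef g 1)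
    + 4 * (1 + 2 * Polynomial.C (bb g 1 1) * Polynomial.X) * (1 - Bcoef g 1) ^ 2

/-- `lam g m` is λ_{2m+2}, defined by 4λ_{2m+2} = coefficient of ξ^{m+1} in `Fg g`. -/
noncomputable def lam (g m : ℕ) : Bg g := ((1 : ℂ) / 4) • ((Fg g).coeff (m + 1))

/-- The polynomial vector field D₁ on B_g:
D₁(b_{1,j}) = b_{2,j}, D₁(b_{2,j}) = b_{3,j},
D₁(b_{3,j}) = 4(2b_{1,1}b_{2,j} + b_{2,1}b_{1,j} + b_{2,j+2}) (with b_{2,2g+1} = 0). -/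
noncomputable def D1g (g : ℕ) : Derivation ℂ (Bg g) (Bg g) :=
  MvPolynomial.mkDerivation ℂ (fun v : Fin 3 × Fin g =>
    if (v.1 : ℕ) = 0 then bb g 2 ((v.2 : ℕ) + 1)
    else if (v.1 : ℕ) = 1 then bb g 3 ((v.2 : ℕ) + 1)
    else 4 * (2 * bb g 1 1 * bb g 2 ((v.2 : ℕ) + 1) + bb g 2 1 * bb g 1 ((v.2 : ℕ) + 1)
      + bb g 2 ((v.2 : ℕ) + 2)))

/-- The polynomial vector field D_s on B_g (for odd s ≥ 3):
D_s(b_{i,j}) = (1/2)·D₁ⁱ(p_{s,j}); for s = 1 it is D₁.  (For s = 2g+1 the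
conventions p_{s,j} = 0 make it the zero vector field.) -/
noncomputable def Dsg (g s : ℕ) : Derivation ℂ (Bg g) (Bg g) :=
  if s = 1 then D1g g else
  MvPolynomial.mkDerivation ℂ (fun v : Fin 3 × Fin g =>
    ((1 : ℂ) / 2) • (((D1g g).toLinearMap ^ ((v.1 : ℕ) + 1)) (pp g s (2 * (v.2 : ℕ) + 1))))

/-- The multiplication operator by c ∈ B_g. -/
noncomputable def mulBg (g : ℕ) (c : Bg g) : Module.End ℂ (Bg g) := LinearMap.mulLeft ℂ c

/-- D_s as a ℂ-linear endomorphism of B_g. -/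
noncomputable def DLg (g s : ℕ) : Module.End ℂ (Bg g) := (Dsg g s).toLinearMap

/-- ℒ = D₁² − 2b_{1,1}. -/
noncomputable def Lg (g : ℕ) : Module.End ℂ (Bg g) := DLg g 1 ^ 2 - mulBg g (2 * bb g 1 1)

/-- The Buchstaber–Shorina polynomial differential operator
ℬ_{2k+1} = D_{2k−1}D₁² − (b_{1,1}D_{2k−1} + D_{2k−1}b_{1,1})
  − (1/2)(b_{1,2k−1}D₁ + D₁b_{1,2k−1}) − D_{2k+1}. -/
noncomputable def Bopg (g k : ℕ) : Module.End ℂ (Bg g) :=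
  DLg g (2 * k - 1) * DLg g 1 ^ 2
    - (mulBg g (bb g 1 1) * DLg g (2 * k - 1) + DLg g (2 * k - 1) * mulBg g (bb g 1 1))
    - ((1 : ℂ) / 2) • (mulBg g (bv g 1 (2 * k - 1)) * DLg g 1 + DLg g 1 * mulBg g (bv g 1 (2 * k - 1)))
    - DLg g (2 * k + 1)

/-- The coefficients b_{1,2n-1}, extended by the value -1 at n = 0, so that the generating
series of `xb` is 𝐛₁(ξ) - 1. -/
def xb (g n : ℕ) : Bg g := if n = 0 then -1 else bb g 1 n

lemma bb_zero_right (g i : ℕ) : bb g i 0 = 0 := by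
  simp [bb]

lemma bb_of_lt {g i n : ℕ} (h : g < n) : bb g i n = 0 := by
  unfold bb
  rw [dif_neg]
  omega

lemma xb_zero (g : ℕ) : xb g 0 = -1 := by simp [xb]

lemma xb_of_pos {g n : ℕ} (h : n ≠ 0) : xb g n = bb g 1 n := by simp [xb, h]

lemma xb_of_lt {g n : ℕ} (h : g < n) : xb g n = 0 := by
  rw [xb_of_pos (by omega), bb_of_lt h]

lemma derivation_bb_eq_of_forall {g : ℕ} (D : Derivation ℂ (Bg g) (Bg g)) (i : Fin 3)
    (F : ℕ → Bg g) (hD : ∀ m : Fin g, D (X (i, m)) = F (m + 1)) (h0 : F 0 = 0)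
    (hF : ∀ n, g < n → F n = 0) (n : ℕ) : D (bb g (i + 1) n) = F n := by
  rcases Nat.eq_zero_or_pos n with rfl | hn
  · rw [bb_zero_right, map_zero, h0]
  rcases lt_or_ge g n with hg | hg
  · rw [bb_of_lt hg, map_zero, hF n hg]
  · have hlt : n - 1 < g := by omega
    have h := hD ⟨n - 1, hlt⟩
    rw [show ((⟨n - 1, hlt⟩ : Fin g) : ℕ) + 1 = n by simp; omega] at h
    rw [← h]
    unfold bb
    rw [dif_pos (by omega)]
    rfl

lemma D1g_bb_one (g n : ℕ) : D1g g (bb g 1 n) = bb g 2 n :=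
  derivation_bb_eq_of_forall (D1g g) 0 (bb g 2) (fun m => by simp [D1g, mkDerivation_X])
    (bb_zero_right g 2) (fun _ => bb_of_lt) n

lemma D1g_bb_two (g n : ℕ) : D1g g (bb g 2 n) = bb g 3 n :=
  derivation_bb_eq_of_forall (D1g g) 1 (bb g 3) (fun m => by simp [D1g, mkDerivation_X])
    (bb_zero_right g 3) (fun _ => bb_of_lt) n

lemma D1g_xb (g n : ℕ) : D1g g (xb g n) = bb g 2 n := by
  rcases eq_or_ne n 0 with rfl | hn
  · simp [xb_zero, bb_zero_right]
  · rw [xb_of_pos hn, D1g_bb_one]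

lemma D1g_bb_three (g n : ℕ) : D1g g (bb g 3 n) =
    4 * (2 * xb g 1 * bb g 2 n + bb g 2 1 * xb g n + bb g 2 (n + 1)) := by
  refine derivation_bb_eq_of_forall (D1g g) 2
    (fun n => 4 * (2 * xb g 1 * bb g 2 n + bb g 2 1 * xb g n + bb g 2 (n + 1)))
    (fun m => ?_) ?_ (fun k hk => ?_) n
  · simp [D1g, mkDerivation_X, xb]
  · simp [bb_zero_right, xb_zero]
  · simp [bb_of_lt hk, xb_of_lt hk, bb_of_lt (hk.trans k.lt_succ_self)]

/-- The polynomial D_{2s-1}(b_{1,2n-1}), given by its recursion in s. -/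
def wb (g : ℕ) : ℕ → ℕ → Bg g
  | 0, _ => 0
  | s + 1, n => wb g s (n + 1) + bb g 2 s * xb g n - xb g s * bb g 2 n

lemma wb_succ (g s n : ℕ) :
    wb g (s + 1) n = wb g s (n + 1) + bb g 2 s * xb g n - xb g s * bb g 2 n := rfl

lemma wb_zero_left (g n : ℕ) : wb g 0 n = 0 := rfl

lemma wb_one_left (g n : ℕ) : wb g 1 n = bb g 2 n := by
  simp [wb, bb_zero_right, xb_zero]

lemma wb_of_lt {g : ℕ} (s : ℕ) : ∀ {n : ℕ}, g < n → wb g s n = 0 := by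
  induction s with
  | zero => intros; rfl
  | succ s ih =>
    intro n h
    rw [wb_succ, ih (h.trans n.lt_succ_self), xb_of_lt h, bb_of_lt h]
    ring

lemma wb_eq_sum (g s : ℕ) : ∀ n, wb g s n = ∑ i ∈ Finset.range s,
    (bb g 2 (s - 1 - i) * xb g (n + i) - xb g (s - 1 - i) * bb g 2 (n + i)) := by
  induction s with
  | zero => intro n; simp [wb]
  | succ s ih =>
    intro n
    rw [wb_succ, ih, Finset.sum_range_succ', add_sub_assoc]
    refine congrArg₂ _ (Finset.sum_congr rfl fun i _ => ?_) ?_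
    · rw [show s + 1 - 1 - (i + 1) = s - 1 - i by omega, show n + (i + 1) = n + 1 + i by omega]
    · simp

lemma wb_zero_right (g s : ℕ) : wb g s 0 = 0 := by
  have h := wb_eq_sum g s 0
  have h' := h
  rw [← Finset.sum_range_reflect] at h'
  have h2 : wb g s 0 = - wb g s 0 := by
    nth_rewrite 2 [h]
    rw [h', ← Finset.sum_neg_distrib]
    refine Finset.sum_congr rfl fun i hi => ?_
    have hi := Finset.mem_range.1 hi
    rw [show s - 1 - (s - 1 - i) = i by omega, zero_add, zero_add]
    ring
  exact self_eq_neg.1 h2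

lemma wb_comm (g s : ℕ) : ∀ n, wb g s n = wb g n s := by
  induction s with
  | zero => intro n; rw [wb_zero_left, wb_zero_right]
  | succ s ih =>
    intro n
    rw [wb_succ, ih, wb_succ]
    ring

lemma D1g_Qg (g : ℕ) : ∀ a n, n ≠ 0 → D1g g (Qg g a n) = 2 * wb g a n := by
  intro a
  induction a using Nat.strong_induction_on with
  | _ a ih =>
  intro n hn
  have hn' : n + 1 ≠ 0 := by omega
  have h2 : D1g g 2 = 0 := (D1g g).map_natCast 2
  have h4 : D1g g 4 = 0 := (D1g g).map_natCast 4
  have h6 : D1g g 6 = 0 := (D1g g).map_natCast 6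
  have h8 : D1g g 8 = 0 := (D1g g).map_natCast 8
  have h10 : D1g g 10 = 0 := (D1g g).map_natCast 10
  match a, ih with
  | 0, _ => simp [Qg, wb]
  | 1, _ =>
    simp only [Qg, Derivation.leibniz, D1g_bb_one, h2, wb_one_left, smul_eq_mul]
    ring
  | 2, _ =>
    simp only [Qg, map_add, map_sub, Derivation.leibniz, D1g_bb_one, D1g_bb_three, h6, wb_succ,
      wb_zero_left, xb_zero, bb_zero_right, smul_eq_mul, xb_of_pos hn, xb_of_pos hn',
      xb_of_pos one_ne_zero]
    ring
  | 3, _ =>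
    simp only [Qg, map_add, map_sub, Derivation.leibniz, D1g_bb_one, D1g_bb_two, D1g_bb_three,
      h2, h4, h10, pow_two, wb_succ, wb_zero_left, xb_zero, bb_zero_right, smul_eq_mul,
      xb_of_pos hn, xb_of_pos hn', xb_of_pos ((n + 1).succ_ne_zero), xb_of_pos one_ne_zero,
      xb_of_pos two_ne_zero, zero_add, one_add_one_eq_two]
    ring
  | a + 4, ih =>
    have e1 : D1g g (if n + 1 ≤ g then Qg g (a + 3) (n + 1) else 0)
        = 2 * wb g (a + 3) (n + 1) := by
      split_ifs with h
      · exact ih _ (by omega) _ (by omega)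
      · rw [wb_of_lt _ (by omega)]; simp
    have e2 : D1g g (if n + 2 ≤ g then Qg g (a + 2) (n + 2) else 0)
        = 2 * wb g (a + 2) (n + 2) := by
      split_ifs with h
      · exact ih _ (by omega) _ (by omega)
      · rw [wb_of_lt _ (by omega)]; simp
    have w1 := wb_succ g (a + 3) n
    have w2 := wb_succ g (a + 2) (n + 1)
    rw [xb_of_pos (n := a + 3) (by omega), xb_of_pos hn] at w1
    rw [xb_of_pos (n := a + 2) (by omega), xb_of_pos hn'] at w2
    have x1 := xb_of_pos (g := g) one_ne_zero
    have x2 := xb_of_pos (g := g) (show a + 2 ≠ 0 by omega)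
    simp only [Qg, map_add, map_sub, Derivation.leibniz, e1, e2, D1g_bb_one, D1g_bb_two,
      D1g_bb_three, h2, h8, smul_eq_mul, x1, x2, xb_of_pos hn]
    linear_combination (-2) * w1 + 2 * w2

lemma D1g_pp {g : ℕ} (hg : 1 ≤ g) (s : ℕ) {n : ℕ} (hn : n ≠ 0) (hng : n ≤ g) :
    D1g g (pp g (2 * s - 1) (2 * n - 1)) = 2 * wb g s n := by
  rcases eq_or_ne s 0 with rfl | hs
  · simp [pp, wb]
  rcases lt_or_ge g s with hsg | hsg
  · rw [pp, if_neg (by omega), wb_comm, wb_of_lt _ hsg]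
    simp
  have hs' : (2 * s - 1 + 1) / 2 = s := by omega
  have hn' : (2 * n - 1 + 1) / 2 = n := by omega
  rw [pp, if_pos ⟨⟨s - 1, by omega⟩, ⟨n - 1, by omega⟩, by omega, by omega⟩, hs', hn']
  split_ifs
  · exact D1g_Qg g s n hn
  · rw [wb_comm]
    exact D1g_Qg g n s hs

/-- The vector field D_{2s-1}; it is zero for s = 0 and for s > g. -/
abbrev vf (g s : ℕ) : Derivation ℂ (Bg g) (Bg g) := Dsg g (2 * s - 1)

lemma vf_one (g : ℕ) : vf g 1 = D1g g := by simp [vf, Dsg]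

lemma vf_X {g : ℕ} (hg : 1 ≤ g) (s : ℕ) (i : Fin 3) (m : Fin g) :
    vf g s (X (i, m)) = ((D1g g).toLinearMap ^ (i : ℕ)) (wb g s (m + 1)) := by
  rcases eq_or_ne s 1 with rfl | hs
  · rw [vf_one, wb_one_left, D1g, mkDerivation_X, ← D1g]
    fin_cases i
    · simp
    · simp [D1g_bb_two]
    · simp [pow_two, D1g_bb_two, D1g_bb_three, xb]
  · rw [vf, Dsg, if_neg (by omega), mkDerivation_X, pow_succ, Module.End.mul_apply]
    have h := D1g_pp hg s (n := m + 1) (by omega) (by omega)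
    rw [show 2 * ((m : ℕ) + 1) - 1 = 2 * m + 1 by omega] at h
    simp only [Derivation.coeFn_coe, h]
    rw [← map_smul]
    congr 1
    rw [two_mul, ← two_smul ℂ, smul_smul]
    norm_num

lemma vf_bb {g : ℕ} (hg : 1 ≤ g) (s : ℕ) (i : Fin 3) (n : ℕ) :
    vf g s (bb g (i + 1) n) = ((D1g g).toLinearMap ^ (i : ℕ)) (wb g s n) :=
  derivation_bb_eq_of_forall (vf g s) i (fun n => ((D1g g).toLinearMap ^ (i : ℕ)) (wb g s n))
    (vf_X hg s i) (by simp [wb_zero_right]) (fun k hk => by simp [wb_of_lt s hk]) n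

lemma vf_xb {g : ℕ} (hg : 1 ≤ g) (s n : ℕ) : vf g s (xb g n) = wb g s n := by
  rcases eq_or_ne n 0 with rfl | hn
  · simp [xb_zero, wb_zero_right]
  · rw [xb_of_pos hn]
    simpa using vf_bb hg s 0 n

lemma vf_bb_two {g : ℕ} (hg : 1 ≤ g) (s n : ℕ) :
    vf g s (bb g 2 n) = D1g g (wb g s n) := by
  simpa using vf_bb hg s 1 n

lemma vf_bb_three {g : ℕ} (hg : 1 ≤ g) (s n : ℕ) :
    vf g s (bb g 3 n) = D1g g (D1g g (wb g s n)) := by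
  simpa [pow_two] using vf_bb hg s 2 n

lemma D1g_cube_wb (g s : ℕ) : ∀ n, D1g g (D1g g (D1g g (wb g s n))) =
    4 * (2 * xb g 1 * D1g g (wb g s n) + bb g 2 1 * wb g s n + D1g g (wb g s (n + 1))
      + 2 * bb g 2 s * bb g 2 n + bb g 3 s * xb g n) := by
  have h2 : D1g g 2 = 0 := (D1g g).map_natCast 2
  have h4 : D1g g 4 = 0 := (D1g g).map_natCast 4
  induction s with
  | zero => intro n; simp [wb_zero_left, bb_zero_right]
  | succ s ih =>
    intro n
    simp only [wb_succ, map_add, map_sub, ih, Derivation.leibniz, D1g_xb, D1g_bb_two,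
      D1g_bb_three, smul_eq_mul, h2, h4]
    ring

lemma vf_D1g {g : ℕ} (hg : 1 ≤ g) (s : ℕ) (f : Bg g) :
    vf g s (D1g g f) = D1g g (vf g s f) := by
  have h2 : vf g s 2 = 0 := (vf g s).map_natCast 2
  have h4 : vf g s 4 = 0 := (vf g s).map_natCast 4
  have h : ⁅vf g s, D1g g⁆ = 0 := by
    refine MvPolynomial.derivation_ext fun ⟨i, m⟩ => ?_
    rw [Derivation.commutator_apply, Derivation.zero_apply, sub_eq_zero]
    have hX : (X (i, m) : Bg g) = bb g (i + 1) (m + 1) := by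
      unfold bb
      rw [dif_pos (by omega)]
      rfl
    rw [hX]
    fin_cases i
    · simpa [D1g_bb_one, vf_bb_two hg, xb_of_pos] using
        (congrArg (D1g g) (vf_xb hg s (m + 1))).symm
    · simpa [D1g_bb_two, vf_bb_two hg] using vf_bb_three hg s (m + 1)
    · have e := vf_bb_three hg s (m + 1)
      have e1 : wb g s 1 = bb g 2 s := by rw [wb_comm, wb_one_left]
      simp only [Nat.reduceAdd, D1g_bb_three, e, D1g_cube_wb, Derivation.leibniz, map_add, h2, h4,
        vf_xb hg, vf_bb_two hg, e1, D1g_bb_two, smul_eq_mul]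
      ring
  rw [← sub_eq_zero, ← Derivation.commutator_apply, h, Derivation.zero_apply]

lemma vf_succ_wb {g : ℕ} (hg : 1 ≤ g) (s t : ℕ) : ∀ n,
    vf g (s + 1) (wb g t n) - vf g s (wb g t (n + 1)) =
      D1g g (wb g s t) * xb g n + bb g 2 s * wb g t n - wb g s t * bb g 2 n
        - xb g s * D1g g (wb g t n) := by
  induction t with
  | zero => intro n; simp [wb_zero_left, wb_zero_right]
  | succ t ih =>
    intro n
    have h := ih (n + 1)
    have e1 : wb g s (t + 1) = wb g (s + 1) t - bb g 2 s * xb g t + xb g s * bb g 2 t := by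
      rw [wb_succ]; ring
    have e2 : wb g t (n + 1) = wb g (t + 1) n - bb g 2 t * xb g n + xb g t * bb g 2 n := by
      rw [wb_succ]; ring
    have e3 : wb g (s + 1) n = wb g s (n + 1) + bb g 2 s * xb g n - xb g s * bb g 2 n := rfl
    have d1 := congrArg (D1g g) e1
    have d2 := congrArg (D1g g) e2
    have d3 := congrArg (D1g g) e3
    simp only [map_add, map_sub, Derivation.leibniz, smul_eq_mul, D1g_xb, D1g_bb_two]
      at d1 d2 d3
    rw [wb_succ g t n, wb_succ g t (n + 1)]
    simp only [map_add, map_sub, Derivation.leibniz, smul_eq_mul, vf_xb hg, vf_bb_two hg,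
      D1g_xb, D1g_bb_two]
    linear_combination h + bb g 2 t * e3 - xb g t * d3 - xb g n * d1 + bb g 2 n * e1

lemma vf_wb_comm {g : ℕ} (hg : 1 ≤ g) (t s : ℕ) : ∀ n,
    vf g t (wb g s n) = vf g s (wb g t n) := by
  induction s with
  | zero =>
    intro n
    have h : vf g 0 = 0 := MvPolynomial.derivation_ext fun ⟨i, m⟩ => by
      rw [vf_X hg, wb_zero_left, map_zero, Derivation.zero_apply]
    rw [wb_zero_left, map_zero, h, Derivation.zero_apply]
  | succ s ih =>
    intro n
    have h := vf_succ_wb hg s t n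
    rw [wb_succ]
    simp only [map_add, map_sub, Derivation.leibniz, smul_eq_mul, vf_xb hg, vf_bb_two hg, ih]
    rw [wb_comm g t s]
    linear_combination -h

lemma vf_comm {g : ℕ} (hg : 1 ≤ g) (s t : ℕ) (f : Bg g) :
    vf g s (vf g t f) = vf g t (vf g s f) := by
  have h : ⁅vf g s, vf g t⁆ = 0 := by
    refine MvPolynomial.derivation_ext fun ⟨i, m⟩ => ?_
    have hc : ∀ (r j : ℕ) (a : Bg g), vf g r (((D1g g).toLinearMap ^ j) a)
        = ((D1g g).toLinearMap ^ j) (vf g r a) := by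
      intro r j
      induction j with
      | zero => intro a; simp
      | succ j ih =>
        intro a
        rw [pow_succ, Module.End.mul_apply, Module.End.mul_apply, ih]
        exact congrArg _ (vf_D1g hg r a)
    rw [Derivation.commutator_apply, Derivation.zero_apply, sub_eq_zero, vf_X hg, vf_X hg, hc, hc,
      vf_wb_comm hg]
  rw [← sub_eq_zero, ← Derivation.commutator_apply, h, Derivation.zero_apply]

/-- The operator ℒ as a map on polynomials. -/
def opL (g : ℕ) (f : Bg g) : Bg g := D1g g (D1g g f) - 2 * xb g 1 * f

/-- The first-order operator -2b_{1,2k-1}D₁ + b_{2,2k-1}. -/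
def opM (g k : ℕ) (f : Bg g) : Bg g := bb g 2 k * f - 2 * xb g k * D1g g f

/-- The operator 2ℬ_{2k+1}, in the form 2D_{2k-1}ℒ - 2b_{1,2k-1}D₁ + b_{2,2k-1} - 2D_{2k+1}. -/
def opB (g k : ℕ) (f : Bg g) : Bg g :=
  2 * vf g k (opL g f) + opM g k f - 2 * vf g (k + 1) f

lemma Lg_apply (g : ℕ) (f : Bg g) : Lg g f = opL g f := by
  simp [Lg, DLg, mulBg, opL, pow_two, Dsg, xb, mul_assoc]

lemma two_mul_Bopg_apply {g k : ℕ} (hg : 1 ≤ g) (hk : 1 ≤ k) (f : Bg g) :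
    2 * Bopg g k f = opB g k f := by
  have hb : bv g 1 (2 * k - 1) = xb g k := by
    rw [bv, if_pos ⟨k - 1, by omega⟩, xb_of_pos (by omega)]
    congr 1
    omega
  have h2 : vf g k 2 = 0 := (vf g k).map_natCast 2
  have hs : ∀ a : Bg g, 2 * (((1 : ℂ) / 2) • a) = a := fun a => by
    rw [two_mul, ← two_smul ℂ, smul_smul]
    norm_num
  have e1 : wb g k 1 = bb g 2 k := by rw [wb_comm, wb_one_left]
  have hD : Dsg g 1 = D1g g := by simp [Dsg]
  have hx : bb g 1 1 = xb g 1 := (xb_of_pos one_ne_zero).symm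
  simp only [Bopg, DLg, mulBg, hb, hD, hx, LinearMap.sub_apply, LinearMap.add_apply,
    LinearMap.smul_apply, Module.End.mul_apply, pow_two, LinearMap.mulLeft_apply,
    Derivation.coeFn_coe, mul_sub, hs]
  rw [show Dsg g (2 * k - 1) = vf g k from rfl, show Dsg g (2 * k + 1) = vf g (k + 1) from rfl]
  simp only [opB, opL, opM, map_sub, Derivation.leibniz, smul_eq_mul, h2, vf_xb hg, D1g_xb, e1]
  ring

lemma opL_vf {g : ℕ} (hg : 1 ≤ g) (k : ℕ) (f : Bg g) :
    opL g (vf g k f) = vf g k (opL g f) + 2 * bb g 2 k * f := by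
  have h2 : vf g k 2 = 0 := (vf g k).map_natCast 2
  have e1 : wb g k 1 = bb g 2 k := by rw [wb_comm, wb_one_left]
  simp only [opL, map_sub, Derivation.leibniz, smul_eq_mul, h2, vf_xb hg, e1, vf_D1g hg]
  ring

lemma opL_opM (g k : ℕ) (f : Bg g) :
    opL g (opM g k f) = opM g k (opL g f) - 4 * bb g 2 k * opL g f + 4 * bb g 2 (k + 1) * f := by
  have h2 : D1g g 2 = 0 := (D1g g).map_natCast 2
  simp only [opL, opM, map_sub, map_add, Derivation.leibniz, smul_eq_mul, h2, D1g_xb, D1g_bb_two,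
    D1g_bb_three, map_zero]
  ring

lemma opL_opB {g : ℕ} (hg : 1 ≤ g) (k : ℕ) (f : Bg g) :
    opL g (opB g k f) = opB g k (opL g f) := by
  have hsub : ∀ a b c : Bg g, opL g (2 * a + b - 2 * c) = 2 * opL g a + opL g b - 2 * opL g c := by
    intro a b c
    have h2 : D1g g 2 = 0 := (D1g g).map_natCast 2
    simp only [opL, map_sub, map_add, Derivation.leibniz, smul_eq_mul, h2, mul_zero]
    ring
  rw [opB, hsub, opL_vf hg, opL_vf hg, opL_opM, opB]
  ring

lemma opB_vf {g : ℕ} (hg : 1 ≤ g) (k l : ℕ) (f : Bg g) :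
    opB g k (vf g l f) = vf g l (opB g k f) + 4 * bb g 2 l * vf g k f
      + 2 * wb g k l * D1g g f + 3 * D1g g (wb g k l) * f := by
  have h2 : ∀ r, vf g r 2 = 0 := fun r => (vf g r).map_natCast 2
  simp only [opB, opL_vf hg, opM, map_sub, map_add, Derivation.leibniz, smul_eq_mul, h2,
    vf_xb hg, vf_bb_two hg, vf_D1g hg, vf_comm hg l k, vf_comm hg l (k + 1), wb_comm g l k]
  ring

lemma vf_opM {g : ℕ} (hg : 1 ≤ g) (k l : ℕ) (f : Bg g) :
    vf g k (opM g l f) = opM g l (vf g k f) + D1g g (wb g k l) * f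
      - 2 * wb g k l * D1g g f := by
  have h2 : vf g k 2 = 0 := (vf g k).map_natCast 2
  simp only [opM, map_sub, Derivation.leibniz, smul_eq_mul, h2, vf_xb hg, vf_bb_two hg,
    vf_D1g hg]
  ring

lemma opM_opM (g k l : ℕ) (f : Bg g) :
    opM g k (opM g l f) = opM g l (opM g k f)
      + 2 * (bb g 3 k * xb g l - xb g k * bb g 3 l) * f
      - 4 * (bb g 2 k * xb g l - xb g k * bb g 2 l) * D1g g f := by
  have h2 : D1g g 2 = 0 := (D1g g).map_natCast 2
  simp only [opM, map_sub, Derivation.leibniz, smul_eq_mul, h2, D1g_xb, D1g_bb_two]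
  ring

lemma opB_opM {g : ℕ} (hg : 1 ≤ g) (k l : ℕ) (f : Bg g) :
    opB g k (opM g l f) = opM g l (opB g k f)
      + 2 * D1g g (wb g k l) * opL g f - 4 * wb g k l * D1g g (opL g f)
      - 8 * vf g k (bb g 2 l * opL g f) + 8 * vf g k (bb g 2 (l + 1) * f)
      + 2 * (bb g 3 k * xb g l - xb g k * bb g 3 l) * f
      - 4 * (bb g 2 k * xb g l - xb g k * bb g 2 l) * D1g g f
      - 2 * D1g g (wb g (k + 1) l) * f + 4 * wb g (k + 1) l * D1g g f := by
  have h2 : D1g g 2 = 0 := (D1g g).map_natCast 2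
  have h4 : vf g k 4 = 0 := (vf g k).map_natCast 4
  have hM : ∀ a b c : Bg g, opM g l (2 * a + b - 2 * c)
      = 2 * opM g l a + opM g l b - 2 * opM g l c := by
    intro a b c
    simp only [opM, map_sub, map_add, Derivation.leibniz, smul_eq_mul, h2]
    ring
  rw [opB, opL_opM, vf_opM hg, opM_opM, opB, hM]
  simp only [map_sub, map_add, vf_opM hg, mul_assoc, Derivation.leibniz, smul_eq_mul, h4]
  ring

lemma opB_comm {g : ℕ} (hg : 1 ≤ g) (k l : ℕ) (f : Bg g) :
    opB g k (opB g l f) = opB g l (opB g k f) := by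
  have hB : ∀ a b c : Bg g, opB g k (2 * a + b - 2 * c)
      = 2 * opB g k a + opB g k b - 2 * opB g k c := by
    intro a b c
    have h2 : D1g g 2 = 0 := (D1g g).map_natCast 2
    have h2' : ∀ r, vf g r 2 = 0 := fun r => (vf g r).map_natCast 2
    simp only [opB, opL, opM, map_sub, map_add, Derivation.leibniz, smul_eq_mul, h2, h2', mul_zero,
      add_zero]
    ring
  have e := wb_succ g k l
  have d := congrArg (D1g g) e
  simp only [map_add, map_sub, Derivation.leibniz, smul_eq_mul, D1g_xb, D1g_bb_two] at d
  rw [opB.eq_def g l f, hB, opB_vf hg, opB_vf hg, opB_opM hg, opB.eq_def g l (opB g k f),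
    opL_opB hg]
  simp only [Derivation.leibniz, smul_eq_mul, vf_bb_two hg]
  linear_combination 4 * D1g g f * e - 2 * f * d

/-- the g+1 polynomial differential operators ℒ, ℬ₃, ℬ₅, …, ℬ_{2g+1}
pairwise commute as ℂ-linear endomorphisms of B_g. -/
theorem stmt8 (g : ℕ) (hg : 1 ≤ g) :
    (∀ k, 1 ≤ k → k ≤ g → Lg g * Bopg g k = Bopg g k * Lg g) ∧
    (∀ k l, 1 ≤ k → k ≤ g → 1 ≤ l → l ≤ g → Bopg g k * Bopg g l = Bopg g l * Bopg g k) := by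
  have hinj : ∀ a b : Bg g, 2 * a = 2 * b → a = b := fun a b h => mul_left_cancel₀ two_ne_zero h
  have hL : ∀ f, opL g (2 * f) = 2 * opL g f := fun f => by
    have h2 : D1g g 2 = 0 := (D1g g).map_natCast 2
    simp only [opL, Derivation.leibniz, smul_eq_mul, h2, mul_zero, add_zero]
    ring
  have hB : ∀ k, 1 ≤ k → ∀ f, opB g k (2 * f) = 2 * opB g k f := fun k hk f => by
    rw [← two_mul_Bopg_apply hg hk, ← two_mul_Bopg_apply hg hk, two_mul f, map_add, ← two_mul]
  refine ⟨fun k hk _ => LinearMap.ext fun f => hinj _ _ ?_,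
    fun k l hk _ hl _ => LinearMap.ext fun f => hinj _ _ (hinj _ _ ?_)⟩
  · rw [Module.End.mul_apply, Module.End.mul_apply, Lg_apply, Lg_apply, ← hL,
      two_mul_Bopg_apply hg hk, two_mul_Bopg_apply hg hk, opL_opB hg]
  · rw [Module.End.mul_apply, Module.End.mul_apply, two_mul_Bopg_apply hg hk,
      two_mul_Bopg_apply hg hl, ← hB k hk, ← hB l hl, two_mul_Bopg_apply hg hk,
      two_mul_Bopg_apply hg hl, opB_comm hg]

end
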